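/- (Γ-liminf inequality for simultaneous limits) Let d ≥ 2, let {r_n} ⊂ (0,1) with r_n → 0⁺ and {s_n} ⊂ (1,+∞) with s_n → 1⁺. Let E ⊆ ℝ^d be measurable with finite Lebesgue measure. Then for every sequence {E_n} of measurable sets of finite Lebesgue measure with χ_{E_n} → χ_E strongly in L¹(ℝ^d), one has ω_{d−1}·Per(E) ≤ liminf_{n→∞} J̃_{r_n}^{s_n}(E_n)/β(r_n, s_n) (as an inequality in [0,+∞]). -/

import Mathlib

open MeasureTheory Filter Set Metric
open scoped ENNReal NNReal symmDiff

noncomputable section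

abbrev Euc (d : ℕ) : Type := EuclideanSpace ℝ (Fin d)

/-- The kernel `k^s_r`. -/
def ker (d : ℕ) (s r t : ℝ) : ℝ :=
  if t ≤ r then r ^ (-((d : ℝ) + s)) else t ^ (-((d : ℝ) + s))

/-- The regularized `s`-fractional perimeter `J̃_r^s(E) = ∫_E ∫_{Eᶜ} k^s_r(|x-y|) dy dx`. -/
def Jt (d : ℕ) (s r : ℝ) (E : Set (Euc d)) : ℝ≥0∞ :=
  ∫⁻ x in E, ∫⁻ y in Eᶜ, ENNReal.ofReal (ker d s r (dist x y))

/-- The scaling factor `σ^s(r)`. -/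
def sgm (d : ℕ) (s r : ℝ) : ℝ :=
  if s = 1 then |Real.log r| else (((d : ℝ) + s) / ((d : ℝ) + 1)) * r ^ (1 - s) / (s - 1)

/-- The scaling factor `β(r,s)` for the simultaneous limit. -/
def betaScale (d : ℕ) (s r : ℝ) : ℝ :=
  (((d : ℝ) + s) / ((d : ℝ) + 1)) * ((r ^ (1 - s) - 1) / (s - 1)) + 1 / ((d : ℝ) + 1)

/-- `ω_k`: Lebesgue measure of the unit ball in `ℝ^k`. -/
def omegaB (k : ℕ) : ℝ := (volume (ball (0 : Euc k) 1)).toReal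

/-- Divergence of a vector field on `ℝ^d`. -/
def diverg {d : ℕ} (Φ : Euc d → Euc d) (x : Euc d) : ℝ :=
  ∑ i : Fin d, fderiv ℝ Φ x (EuclideanSpace.single i 1) i

/-- De Giorgi perimeter. -/
def Per (d : ℕ) (E : Set (Euc d)) : ℝ≥0∞ :=
  ⨆ (Φ : Euc d → Euc d) (_ : ContDiff ℝ 1 Φ) (_ : HasCompactSupport Φ)
    (_ : ∀ x, ‖Φ x‖ ≤ 1), ENNReal.ofReal (∫ x in E, diverg Φ x)

/-- The cube `lQ + ξ` where `Q = [-1/2, 1/2)^d`. -/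
def cube (d : ℕ) (l : ℝ) (ξ : Euc d) : Set (Euc d) :=
  {x | ∀ i, x i ∈ Set.Ico (ξ i - l / 2) (ξ i + l / 2)}

/-- Half space `H⁻_ν(0)`. -/
def Hminus (d : ℕ) (ν : Euc d) : Set (Euc d) := {y | @inner ℝ _ _ ν y ≤ 0}

/-- Standard (normalized) `k`-dimensional Hausdorff measure on `ℝ^d`:
Mathlib's `μH[k]` uses `diam^k` gauges without the normalizing constant `ω_k/2^k`. -/
def Hstd (d : ℕ) (k : ℕ) : Measure (Euc d) :=
  (ENNReal.ofReal (omegaB k / 2 ^ k)) • (μH[(k : ℝ)] : Measure (Euc d))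

/-- The nonlocal `k^s_r`-curvature. -/
def curv (d : ℕ) (s r : ℝ) (E : Set (Euc d)) (x : Euc d) : ℝ :=
  ∫ y, (Set.indicator Eᶜ (fun _ => (1 : ℝ)) y - Set.indicator E (fun _ => (1 : ℝ)) y)
    * ker d s r (dist x y)

/-- The class `𝔈`: closures of open sets with compact `C²` boundary. -/
def IsC2Domain (d : ℕ) (E : Set (Euc d)) : Prop :=
  ∃ U : Set (Euc d), IsOpen U ∧ E = closure U ∧ IsCompact (frontier U) ∧
    ∃ f : Euc d → ℝ, ContDiff ℝ 2 f ∧ U = {x | f x < 0} ∧ frontier U = {x | f x = 0} ∧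
      ∀ x ∈ frontier U, fderiv ℝ f x ≠ 0

lemma polar_hom (d : ℕ) (hd : 2 ≤ d) (F : Euc d → ℝ) (hF : ∀ t : ℝ, 0 < t → ∀ x, F (t • x) = t * F x)
    (κ : ℝ → ℝ) :
    ∫ x, κ ‖x‖ * F x = (∫ θ : sphere (0 : Euc d) 1, F θ ∂(volume : Measure (Euc d)).toSphere) *
      ∫ t in Ioi (0 : ℝ), t ^ d * κ t := by
  have : Nonempty (Fin d) := ⟨⟨0, by omega⟩⟩
  have hdim : Module.finrank ℝ (Euc d) = d := by simp
  calc
    ∫ x, κ ‖x‖ * F x = ∫ x : ({(0)}ᶜ : Set (Euc d)), κ ‖x.1‖ * F x.1 ∂((volume : Measure (Euc d)).comap Subtype.val) := by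
      rw [integral_subtype_comap (measurableSet_singleton _).compl fun x : Euc d ↦ κ ‖x‖ * F x,
        restrict_compl_singleton]
    _ = ∫ x : sphere (0 : Euc d) 1 × Ioi (0 : ℝ), F x.1 * (x.2.1 * κ x.2) ∂(volume : Measure (Euc d)).toSphere.prod (.volumeIoiPow (Module.finrank ℝ (Euc d) - 1)) := by
      rw [← (volume : Measure (Euc d)).measurePreserving_homeomorphUnitSphereProd.integral_comp
        (Homeomorph.measurableEmbedding _)]
      refine integral_congr_ae (ae_of_all _ fun x => ?_)
      have hx : 0 < ‖x.1‖ := norm_pos_iff.2 x.2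
      have : F x.1 = ‖x.1‖ * F (‖x.1‖⁻¹ • x.1) := by
        rw [← hF _ hx, smul_smul, mul_inv_cancel₀ hx.ne', one_smul]
      simp only [homeomorphUnitSphereProd_apply_snd_coe, homeomorphUnitSphereProd_apply_fst_coe]
      rw [this]; ring
    _ = (∫ θ : sphere (0 : Euc d) 1, F θ ∂(volume : Measure (Euc d)).toSphere) * ∫ x : Ioi (0 : ℝ), x.1 * κ x ∂.volumeIoiPow (Module.finrank ℝ (Euc d) - 1) :=
      integral_prod_mul (fun θ : sphere (0 : Euc d) 1 => F θ) (fun x : Ioi (0 : ℝ) => x.1 * κ x)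
    _ = _ := by
      congr 1
      simp only [Measure.volumeIoiPow, ENNReal.ofReal]
      rw [integral_withDensity_eq_integral_smul,
        integral_subtype_comap measurableSet_Ioi fun a ↦ Real.toNNReal (a ^ (Module.finrank ℝ (Euc d) - 1)) • (a * κ a),
        setIntegral_congr_fun measurableSet_Ioi fun x hx ↦ ?_]
      · rw [NNReal.smul_def, Real.coe_toNNReal _ (pow_nonneg hx.out.le _), hdim, smul_eq_mul, ← mul_assoc, ← pow_succ, Nat.sub_add_cancel (by omega)]
      · exact (measurable_subtype_coe.pow_const _).real_toNNReal

lemma measurable_sign' : Measurable Real.sign := by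
  unfold Real.sign
  exact Measurable.ite measurableSet_Iio measurable_const
    (Measurable.ite measurableSet_Ioi measurable_const measurable_const)

lemma abs_sign_le (x : ℝ) : |Real.sign x| ≤ 1 := by
  rcases Real.sign_apply_eq x with h | h | h <;> simp [h]

lemma sign_mul_self' (x : ℝ) : Real.sign x * x = |x| := by
  rcases lt_trichotomy x 0 with h | h | h
  · simp [Real.sign_of_neg h, abs_of_neg h]
  · simp [h]
  · simp [Real.sign_of_pos h, abs_of_pos h]

lemma gamma_half (d : ℕ) : ∫ t in Ioi (0 : ℝ), t ^ d * Real.exp (-t ^ 2) = Real.Gamma (((d : ℝ) + 1) / 2) / 2 := by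
  have := integral_rpow_mul_exp_neg_rpow (p := 2) (q := d) (by norm_num) (by have : (0:ℝ) ≤ d := by positivity
                                                                             linarith)
  rw [one_div_mul_eq_div] at this
  rw [← this]
  refine setIntegral_congr_fun measurableSet_Ioi fun x hx => ?_
  simp

lemma int_gauss : ∫ t : ℝ, Real.exp (-t ^ 2) = √Real.pi := by
  have := integral_gaussian 1
  simpa using this

lemma int_gauss_odd : ∫ t : ℝ, Real.exp (-t ^ 2) * t = 0 := by
  have := integral_neg_eq_self (fun t : ℝ => Real.exp (-t ^ 2) * t) volume
  simp only [even_two, Even.neg_pow, mul_neg, integral_neg] at this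
  linarith

lemma int_gauss_abs : ∫ t : ℝ, Real.exp (-t ^ 2) * |t| = 1 := by
  have h := integral_comp_abs (f := fun t : ℝ => Real.exp (-t ^ 2) * t)
  simp only [sq_abs] at h
  rw [h]
  have := gamma_half 1
  norm_num at this
  simp_rw [mul_comm (Real.exp _)]
  rw [this]; norm_num

lemma gauss_coord (d : ℕ) (i j : Fin d) :
    ∫ x : Euc d, Real.exp (-‖x‖ ^ 2) * (Real.sign (x i) * x j) = if j = i then √Real.pi ^ (d - 1) else 0 := by
  have h1 : ∀ x : Euc d, Real.exp (-‖x‖ ^ 2) * (Real.sign (x i) * x j) =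
      ∏ k, (Real.exp (-(x k) ^ 2) * ((if k = i then Real.sign (x k) else 1) * (if k = j then x k else 1))) := by
    intro x
    rw [Finset.prod_mul_distrib, Finset.prod_mul_distrib, ← Real.exp_sum, EuclideanSpace.norm_sq_eq]
    simp
  simp_rw [h1]
  have h2 := (EuclideanSpace.volume_preserving_symm_measurableEquiv_toLp (Fin d)).integral_comp'
    (fun y : Fin d → ℝ => ∏ k, (Real.exp (-(y k) ^ 2) * ((if k = i then Real.sign (y k) else 1) * (if k = j then y k else 1))))
  refine Eq.trans h2 ?_
  rw [integral_fintype_prod_volume_eq_prod (fun (k : Fin d) (t : ℝ) => Real.exp (-t ^ 2) * ((if k = i then Real.sign t else 1) * (if k = j then t else 1)))]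
  split_ifs with hij
  · subst hij
    rw [← Finset.mul_prod_erase _ _ (Finset.mem_univ j)]
    simp only [if_true, sign_mul_self', int_gauss_abs, one_mul]
    rw [Finset.prod_congr rfl (g := fun _ => √Real.pi)]
    · simp
    · intro k hk
      have := Finset.ne_of_mem_erase hk
      simp [this, int_gauss]
  · apply Finset.prod_eq_zero (Finset.mem_univ j)
    simp [hij, int_gauss_odd]

lemma integrable_gauss (d : ℕ) : Integrable (fun x : Euc d => Real.exp (-‖x‖ ^ 2) * ‖x‖) := by
  rcases Nat.eq_zero_or_pos d with rfl | hd
  · exact Integrable.of_subsingleton 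
  have : Nonempty (Fin d) := ⟨⟨0, hd⟩⟩
  rw [integrable_fun_norm_addHaar volume (f := fun t => Real.exp (-t ^ 2) * t)]
  have := integrableOn_rpow_mul_exp_neg_mul_sq (b := 1) (s := d) one_pos (by have : (0:ℝ) ≤ d := by positivity
                                                                             linarith)
  refine this.congr_fun ?_ measurableSet_Ioi
  intro x hx
  have : x ^ d = x ^ (d-1) * x := by rw [← pow_succ, Nat.sub_add_cancel hd]
  simp [this]; ring

lemma integrable_gauss' (d : ℕ) (w u : Euc d) : Integrable (fun x : Euc d => Real.exp (-‖x‖ ^ 2) * (Real.sign (inner ℝ x w) * inner ℝ x u)) := by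
  refine ((integrable_gauss d).mul_const ‖u‖).mono' ?_ ?_
  · have := measurable_sign'
    apply Measurable.aestronglyMeasurable
    fun_prop
  · refine ae_of_all _ fun x => ?_
    simp only [norm_mul, Real.norm_eq_abs, Real.abs_exp]
    rw [mul_assoc]
    refine mul_le_mul_of_nonneg_left ?_ (Real.exp_pos _).le
    calc _ ≤ 1 * (‖x‖ * ‖u‖) := by
          gcongr
          · exact abs_sign_le _
          · exact abs_real_inner_le_norm _ _
      _ = _ := one_mul _

lemma gauss_inner (d : ℕ) (hd : 2 ≤ d) (w u : Euc d) :
    ‖w‖ * ∫ x : Euc d, Real.exp (-‖x‖ ^ 2) * (Real.sign (inner ℝ x w) * inner ℝ x u) = √Real.pi ^ (d - 1) * inner ℝ w u := by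
  let i : Fin d := ⟨0, by omega⟩
  let e : Euc d := EuclideanSpace.single i 1
  have hbase : ∀ u : Euc d, ∫ x : Euc d, Real.exp (-‖x‖ ^ 2) * (Real.sign (inner ℝ x e) * inner ℝ x u) = √Real.pi ^ (d - 1) * inner ℝ e u := by
    intro u
    have hi : ∀ j : Fin d, Integrable (fun x : Euc d => u j * (Real.exp (-‖x‖ ^ 2) * (Real.sign (x i) * x j))) := by
      intro j
      have := (integrable_gauss' d e (EuclideanSpace.single j 1)).const_mul (u j)
      simpa [e, EuclideanSpace.inner_single_right] using this
    have : ∀ x : Euc d, Real.exp (-‖x‖ ^ 2) * (Real.sign (inner ℝ x e) * inner ℝ x u) = ∑ j, u j * (Real.exp (-‖x‖ ^ 2) * (Real.sign (x i) * x j)) := by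
      intro x
      simp only [e, PiLp.inner_apply, Finset.mul_sum]
      simp
      refine Finset.sum_congr rfl fun j _ => by ring
    simp_rw [this]
    rw [integral_finsetSum _ (fun j _ => hi j)]
    simp_rw [integral_const_mul, gauss_coord]
    simp [e, EuclideanSpace.inner_single_left, mul_comm]
  rcases eq_or_ne w 0 with rfl | hw
  · simp
  have hw' : 0 < ‖w‖ := norm_pos_iff.2 hw
  set w1 : Euc d := ‖w‖⁻¹ • w with hw1
  have hn : ‖w1‖ = ‖e‖ := by simp [w1, e, norm_smul, hw'.ne']
  let ρ := Submodule.reflection (Submodule.span ℝ {w1 - e})ᗮ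
  have hρ : ρ w1 = e := Submodule.reflection_sub hn
  have h := (ρ.measurePreserving).integral_comp' (f := ρ.toHomeomorph.toMeasurableEquiv) (fun x : Euc d => Real.exp (-‖x‖ ^ 2) * (Real.sign (inner ℝ x e) * inner ℝ x (ρ u)))
  have hww : w = ‖w‖ • w1 := by rw [hw1, smul_smul, mul_inv_cancel₀ hw'.ne', one_smul]
  have hs : ∀ x, Real.sign (inner ℝ x w) = Real.sign (inner ℝ x w1) := by
    intro x
    rw [hw1, inner_smul_right]
    rcases lt_trichotomy (inner ℝ x w) 0 with h | h | h
    · rw [Real.sign_of_neg h, Real.sign_of_neg (mul_neg_of_pos_of_neg (by positivity) h)]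
    · simp [h]
    · rw [Real.sign_of_pos h, Real.sign_of_pos (by positivity)]
  rw [hbase] at h
  have h2 : ∫ x : Euc d, Real.exp (-‖x‖ ^ 2) * (Real.sign (inner ℝ x w) * inner ℝ x u) = √Real.pi ^ (d - 1) * inner ℝ e (ρ u) := by
    rw [← h]
    refine integral_congr_ae (ae_of_all _ fun x => ?_)
    simp [hs, ← hρ]
  rw [h2, ← hρ, ρ.inner_map_map, hw1, inner_smul_left]
  simp
  field_simp

lemma omegaB_eq (d : ℕ) (hd : 2 ≤ d) :
    omegaB (d - 1) = √Real.pi ^ (d - 1) / Real.Gamma (((d : ℝ) + 1) / 2) := by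
  have : Nonempty (Fin (d-1)) := ⟨⟨0, by omega⟩⟩
  have : ((d - 1 : ℕ) : ℝ) / 2 + 1 = ((d : ℝ) + 1) / 2 := by
    rw [Nat.cast_sub (by omega)]; push_cast; ring
  unfold omegaB
  rw [EuclideanSpace.volume_ball, Fintype.card_fin, this]
  simp
  exact div_nonneg (by positivity) (Real.Gamma_nonneg_of_nonneg (by positivity))

lemma measurable_ker (d : ℕ) (s r : ℝ) : Measurable (ker d s r) := by
  unfold _root_.ker
  exact Measurable.ite measurableSet_Iic measurable_const (by fun_prop)

lemma Jt_eq (d : ℕ) (s r : ℝ) (F : Set (Euc d)) (hF : MeasurableSet F) :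
    Jt d s r F = ∫⁻ h, ENNReal.ofReal (ker d s r ‖h‖) * volume (F \ (fun x => x + h) ⁻¹' F) := by
  have hk := measurable_ker d s r
  have h1 : ∀ x : Euc d, ∫⁻ y in Fᶜ, ENNReal.ofReal (ker d s r (dist x y)) =
      ∫⁻ h, Fᶜ.indicator (fun _ => ENNReal.ofReal (ker d s r ‖h‖)) (x + h) := by
    intro x
    rw [← lintegral_indicator hF.compl,
      ← lintegral_add_left_eq_self (μ := volume) _ x]
    congr with h
    by_cases hx : x + h ∈ F <;> simp [hx, dist_eq_norm]
  unfold Jt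
  simp_rw [h1]
  have hm : Measurable (fun q : Euc d × Euc d => Fᶜ.indicator (fun _ => ENNReal.ofReal (ker d s r ‖q.2‖)) (q.1 + q.2)) := by
    have : (fun q : Euc d × Euc d => Fᶜ.indicator (fun _ => ENNReal.ofReal (ker d s r ‖q.2‖)) (q.1 + q.2)) =
        ((fun q : Euc d × Euc d => q.1 + q.2) ⁻¹' Fᶜ).indicator (fun q => ENNReal.ofReal (ker d s r ‖q.2‖)) := by
      ext q; rfl
    rw [this]
    exact Measurable.indicator (by fun_prop) ((measurable_fst.add measurable_snd) hF.compl)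
  rw [lintegral_lintegral_swap hm.aemeasurable]
  congr with h
  have : ∀ x : Euc d, Fᶜ.indicator (fun _ => ENNReal.ofReal (ker d s r ‖h‖)) (x + h) =
      ((fun x => x + h) ⁻¹' Fᶜ).indicator (fun _ => ENNReal.ofReal (ker d s r ‖h‖)) x := fun x => rfl
  simp_rw [this]
  rw [lintegral_indicator_const ((measurable_add_const h) hF.compl), Measure.restrict_apply ((measurable_add_const h) hF.compl)]
  congr 2
  ext x; simp [and_comm]

lemma measure_lower (d : ℕ) (F : Set (Euc d)) (hF : MeasurableSet F) (hFf : volume F < ⊤) (h : Euc d)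
    (ψ : Euc d → ℝ) (hψ : Continuous ψ) (h0 : ∀ x, 0 ≤ ψ x) (h1 : ∀ x, ψ x ≤ 1) :
    ∫ x in F, (ψ x - ψ (x - h)) ≤ (volume (F \ (fun x => x + h) ⁻¹' F)).toReal := by
  set F' := (fun x => x + h) ⁻¹' F with hF'
  have hmF' : MeasurableSet F' := (measurable_add_const h) hF
  have hF'f : volume F' < ⊤ := by
    rw [hF', measure_preimage_add_right]; exact hFf
  have hint : ∀ (G : Set (Euc d)) (f : Euc d → ℝ), volume G < ⊤ → Continuous f → (∀ x, 0 ≤ f x) → (∀ x, f x ≤ 1) → IntegrableOn f G := by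
    intro G f hG hf h0 h1
    refine Measure.integrableOn_of_bounded (M := 1) hG.ne hf.aestronglyMeasurable (ae_of_all _ fun x => ?_)
    rw [Real.norm_eq_abs, abs_of_nonneg (h0 x)]; exact h1 x
  rw [integral_sub (hint F ψ hFf hψ h0 h1) (hint F (fun x => ψ (x - h)) hFf (by fun_prop) (fun x => h0 _) (fun x => h1 _))]
  have e1 : ∫ x in F, ψ (x - h) = ∫ x in F', ψ x := by
    rw [← integral_indicator hF, ← integral_indicator hmF', ← integral_add_right_eq_self _ h]
    congr with x
    by_cases hx : x + h ∈ F <;> simp [F', hx]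
  rw [e1, ← integral_inter_add_sdiff hmF' (hint F ψ hFf hψ h0 h1)]
  have e2 : ∫ x in F ∩ F', ψ x ≤ ∫ x in F', ψ x :=
    setIntegral_mono_set (hint F' ψ hF'f hψ h0 h1) (ae_of_all _ h0) (ae_of_all _ inter_subset_right)
  have hd : volume (F \ F') < ⊤ := (measure_mono sdiff_subset).trans_lt hFf
  have e3 : ∫ x in F \ F', ψ x ≤ (volume (F \ F')).toReal := by
    have := setIntegral_mono (hint _ ψ hd hψ h0 h1) (integrableOn_const (C := (1:ℝ)) hd.ne) (fun x => h1 x)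
    simpa [Measure.real] using this
  linarith

lemma diffquot (d : ℕ) (p : Euc d → ℝ) (hp : ContDiff ℝ 1 p) (hc : HasCompactSupport (fderiv ℝ p)) (η : ℝ) (hη : 0 < η) :
    ∃ δ > 0, ∀ h : Euc d, ‖h‖ < δ → ∀ x, |p x - p (x - h) - fderiv ℝ p x h| ≤ η * ‖h‖ := by
  have hcont : Continuous (fderiv ℝ p) := hp.continuous_fderiv (by norm_num)
  have huc := hc.uniformContinuous_of_continuous hcont
  obtain ⟨δ, hδ, H⟩ := Metric.uniformContinuous_iff.1 huc η hη
  refine ⟨δ, hδ, fun h hh x => ?_⟩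
  have hdiff : Differentiable ℝ p := hp.differentiable (by norm_num)
  have := (convex_ball x δ).norm_image_sub_le_of_norm_hasFDerivWithin_le' (f := p) (f' := fderiv ℝ p) (φ := fderiv ℝ p x) (C := η)
    (x := x - h) (y := x) (fun y _ => (hdiff y).hasFDerivAt.hasFDerivWithinAt) (fun y hy => ?_) (by simpa using hh) (by simpa using hδ)
  · simpa using this
  · rw [← dist_eq_norm]; exact (H hy).le

lemma per_i (d : ℕ) (p : Euc d → ℝ) (hp : ContDiff ℝ 1 p) (hc : HasCompactSupport (fderiv ℝ p))
    (hb0 : ∀ x, 0 ≤ p x) (hb1 : ∀ x, p x ≤ 1)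
    (E : Set (Euc d)) (hE : MeasurableSet E) (hEf : volume E < ⊤) (η : ℝ) (hη : 0 < η) :
    ∀ᶠ δ in nhdsWithin (0 : ℝ) (Ioi 0), ∀ F : Set (Euc d), MeasurableSet F → volume F < ⊤ →
      volume (F ∆ E) < ENNReal.ofReal δ → ∀ h : Euc d, ‖h‖ < δ →
      |(∫ x in F, (p x - p (x - h))) - ∫ x in E, fderiv ℝ p x h| ≤ η * ‖h‖ := by
  have hcont : Continuous (fderiv ℝ p) := hp.continuous_fderiv (by norm_num)
  obtain ⟨C, hC⟩ := hc.exists_bound_of_continuous hcont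
  have hC0 : 0 ≤ C := (norm_nonneg _).trans (hC 0)
  set M := (volume E).toReal + 1 with hM
  have hM1 : 0 < M := by positivity
  obtain ⟨δ₁, hδ₁, H⟩ := diffquot d p hp hc (η / 2 / M) (by positivity)
  have hev : ∀ᶠ δ in nhdsWithin (0 : ℝ) (Ioi 0), δ ∈ Ioo 0 (min δ₁ (min 1 (η / 2 / (C + 1)))) :=
    Ioo_mem_nhdsGT (by positivity)
  filter_upwards [hev] with δ hδ F hF hFf hFE h hh
  obtain ⟨hδ0, hδ'⟩ := hδ
  simp only [lt_min_iff] at hδ'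
  obtain ⟨hd1, hd2, hd3⟩ := hδ'
  have hsub : volume.real (F ∆ E) ≤ δ := ENNReal.toReal_le_of_le_ofReal hδ0.le hFE.le
  have hFM : volume.real F ≤ M := by
    have : F ⊆ E ∪ F ∆ E := by
      intro x hx
      by_cases hxE : x ∈ E
      · exact Or.inl hxE
      · exact Or.inr (Or.inl ⟨hx, hxE⟩)
    have hfin : volume (F ∆ E) ≠ ⊤ := (hFE.trans ENNReal.ofReal_lt_top).ne
    calc volume.real F ≤ volume.real (E ∪ F ∆ E) := measureReal_mono this (measure_union_lt_top hEf hfin.lt_top).ne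
      _ ≤ volume.real E + volume.real (F ∆ E) := measureReal_union_le _ _
      _ ≤ M := by rw [hM]; unfold Measure.real at *; linarith
  have hci : ∀ G : Set (Euc d), volume G < ⊤ → IntegrableOn (fun x => fderiv ℝ p x h) G := by
    intro G hG
    refine Measure.integrableOn_of_bounded (M := C * ‖h‖) hG.ne (by fun_prop) (ae_of_all _ fun x => ?_)
    exact (ContinuousLinearMap.le_opNorm _ _).trans (by gcongr; exact hC x)
  have hpc : Continuous p := hp.continuous
  have hpi : IntegrableOn (fun x => p x - p (x - h)) F := by
    refine Measure.integrableOn_of_bounded (M := 1) hFf.ne (by fun_prop) (ae_of_all _ fun x => ?_)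
    rw [Real.norm_eq_abs, abs_le]
    constructor <;> linarith [hb0 x, hb1 x, hb0 (x - h), hb1 (x - h)]
  have b1 : |(∫ x in F, (p x - p (x - h))) - ∫ x in F, fderiv ℝ p x h| ≤ η / 2 * ‖h‖ := by
    rw [← integral_sub hpi (hci F hFf)]
    have := norm_setIntegral_le_of_norm_le_const (μ := volume) (s := F) (f := fun x => (p x - p (x - h)) - fderiv ℝ p x h) (C := η / 2 / M * ‖h‖) hFf
      (fun x _ => H h (hh.trans hd1) x)
    refine this.trans ?_
    calc η / 2 / M * ‖h‖ * volume.real F ≤ η / 2 / M * ‖h‖ * M := by gcongr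
      _ = _ := by field_simp
  have b2 : |(∫ x in F, fderiv ℝ p x h) - ∫ x in E, fderiv ℝ p x h| ≤ η / 2 * ‖h‖ := by
    rw [← integral_inter_add_sdiff hE (hci F hFf), ← integral_inter_add_sdiff hF (hci E hEf), inter_comm E F]
    have hb : ∀ G : Set (Euc d), volume G < ⊤ → |∫ x in G, fderiv ℝ p x h| ≤ C * ‖h‖ * volume.real G := by
      intro G hG
      refine norm_setIntegral_le_of_norm_le_const (f := fun x => fderiv ℝ p x h) hG (fun x _ => ?_)
      exact (ContinuousLinearMap.le_opNorm _ _).trans (by gcongr; exact hC x)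
    have f1 : volume (F \ E) < ⊤ := (measure_mono sdiff_subset).trans_lt hFf
    have f2 : volume (E \ F) < ⊤ := (measure_mono sdiff_subset).trans_lt hEf
    have hsum : volume.real (F ∆ E) = volume.real (F \ E) + volume.real (E \ F) := by
      rw [Set.symmDiff_def, measureReal_union (disjoint_sdiff_sdiff) (hE.diff hF) f1.ne f2.ne]
    have := hb _ f1
    have := hb _ f2
    have h3 : C * ‖h‖ * volume.real (F ∆ E) ≤ η / 2 * ‖h‖ := by
      have : C * volume.real (F ∆ E) ≤ η / 2 := by
        calc C * volume.real (F ∆ E) ≤ (C + 1) * (η / 2 / (C + 1)) := by gcongr <;> linarith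
          _ = _ := by field_simp
      nlinarith [norm_nonneg h]
    rw [hsum, mul_add] at h3
    rw [add_sub_add_left_eq_sub]
    refine (abs_sub _ _).trans ?_
    linarith
  calc _ ≤ _ := abs_sub_le _ (∫ x in F, fderiv ℝ p x h) _
    _ ≤ _ := by linarith

lemma decomp_aux (d : ℕ) (ρ : ℝ) (hρ : ρ < 1) :
    ∃ (ι : Type) (_ : Fintype ι) (P : ι → Euc d → ℝ) (w : ι → Euc d),
      (∀ (Φ : Euc d → Euc d), ContDiff ℝ 1 Φ → (∀ x, ‖Φ x‖ ≤ ρ) → ∀ i, ContDiff ℝ 1 (fun x => P i (Φ x))) ∧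
      ∀ v, ‖v‖ ≤ ρ → (∀ i, 0 ≤ P i v) ∧ (∀ i, P i v ≤ 1) ∧ ∑ i, P i v * ‖w i‖ ≤ 1 ∧ ∑ i, P i v • w i = v := by
  set τ : ℝ := (1 - ρ) / (d + 1) with hτ
  have hτ0 : 0 < τ := by
    have : 0 < 1 - ρ := by linarith
    positivity
  rcases lt_or_ge ρ 0 with hneg | hρ0
  · refine ⟨Empty, inferInstance, fun _ _ => 0, fun _ => 0, by simp, fun v hv => ?_⟩
    linarith [norm_nonneg v]
  have hτ1 : τ ≤ 1 := by
    rw [hτ, div_le_one (by positivity)]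
    have : (0:ℝ) ≤ d := by positivity
    linarith
  obtain ⟨t, ht, htf, hcov⟩ := (isCompact_closedBall (0 : Euc d) ρ).finite_cover_balls (e := τ / 2) (by positivity)
  have : Fintype t := htf.fintype
  let b : (i : t) → ContDiffBump (i : Euc d) := fun i => ⟨τ / 2, τ, by positivity, by linarith⟩
  let S : Euc d → ℝ := fun v => ∑ i : t, b i v
  let A : t → Euc d → ℝ := fun i v => b i v / S v
  let e : Euc d → Euc d := fun v => v - ∑ i : t, A i v • (i : Euc d)
  have hS : ∀ v, ‖v‖ ≤ ρ → 0 < S v := by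
    intro v hv
    have hv' : v ∈ closedBall (0 : Euc d) ρ := by simpa using hv
    obtain ⟨i, hi, hvi⟩ := mem_iUnion₂.1 (hcov hv')
    have h1 : b ⟨i, hi⟩ v = 1 := (b ⟨i, hi⟩).one_of_mem_closedBall (ball_subset_closedBall hvi)
    calc (0:ℝ) < b ⟨i, hi⟩ v := by rw [h1]; exact one_pos
      _ ≤ S v := Finset.single_le_sum (f := fun i : t => b i v) (fun j _ => (b j).nonneg) (Finset.mem_univ _)
  have hA0 : ∀ v, ‖v‖ ≤ ρ → ∀ i, 0 ≤ A i v := fun v hv i => div_nonneg (b i).nonneg (hS v hv).le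
  have hA1 : ∀ v, ‖v‖ ≤ ρ → ∑ i, A i v = 1 := by
    intro v hv
    rw [← Finset.sum_div]
    exact div_self (hS v hv).ne'
  have hAd : ∀ v i, A i v ≠ 0 → ‖v - i‖ ≤ τ := by
    intro v i h
    have : b i v ≠ 0 := by
      intro h0; apply h; simp [A, h0]
    by_contra! hc
    apply this
    exact (b i).zero_of_le_dist (by rw [dist_eq_norm]; exact hc.le)
  have he : ∀ v, ‖v‖ ≤ ρ → ‖e v‖ ≤ τ := by
    intro v hv
    have : e v = ∑ i : t, A i v • (v - i) := by
      simp only [smul_sub, Finset.sum_sub_distrib, ← Finset.sum_smul, hA1 v hv, one_smul]; rfl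
    rw [this]
    calc _ ≤ ∑ i : t, ‖A i v • (v - i)‖ := norm_sum_le _ _
      _ ≤ ∑ i : t, A i v * τ := by
          refine Finset.sum_le_sum fun i _ => ?_
          rw [norm_smul, Real.norm_of_nonneg (hA0 v hv i)]
          by_cases h : A i v = 0
          · simp [h]
          · exact mul_le_mul_of_nonneg_left (hAd v i h) (hA0 v hv i)
      _ = τ := by rw [← Finset.sum_mul, hA1 v hv, one_mul]
  have hej : ∀ v, ‖v‖ ≤ ρ → ∀ j, |e v j| ≤ τ := fun v hv j => (PiLp.norm_apply_le (e v) j).trans (he v hv)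
  have hti : ∀ i : t, ‖(i : Euc d)‖ ≤ ρ := fun i => by simpa using ht i.2
  refine ⟨t ⊕ (Fin d ⊕ Fin d), inferInstance,
    Sum.elim A (Sum.elim (fun j v => (τ + e v j) / 2) (fun j v => (τ - e v j) / 2)),
    Sum.elim (fun i => (i : Euc d)) (Sum.elim (fun j => EuclideanSpace.single j 1) (fun j => - EuclideanSpace.single j 1)), ?_, ?_⟩
  · intro Φ hΦ hΦρ
    have hb : ∀ i, ContDiff ℝ 1 (fun x => b i (Φ x)) := fun i => (b i).contDiff.comp hΦ
    have hA : ∀ i, ContDiff ℝ 1 (fun x => A i (Φ x)) := by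
      intro i
      refine (hb i).div (ContDiff.sum fun i _ => hb i) fun x => (hS _ (hΦρ x)).ne'
    have hec : ContDiff ℝ 1 (fun x => e (Φ x)) :=
      hΦ.sub (ContDiff.sum fun i _ => (hA i).smul contDiff_const)
    have hecj : ∀ j, ContDiff ℝ 1 (fun x => e (Φ x) j) := fun j => (contDiff_euclidean.1 hec) j
    rintro (i | j | j)
    · exact hA i
    · exact (contDiff_const.add (hecj j)).div_const 2
    · exact (contDiff_const.sub (hecj j)).div_const 2
  · intro v hv
    refine ⟨?_, ?_, ?_, ?_⟩
    · rintro (i | j | j)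
      · exact hA0 v hv i
      · have := abs_le.1 (hej v hv j)
        simp; linarith
      · have := abs_le.1 (hej v hv j)
        simp; linarith
    · rintro (i | j | j)
      · rw [← hA1 v hv]
        exact Finset.single_le_sum (f := fun i : t => A i v) (fun j _ => hA0 v hv j) (Finset.mem_univ i)
      · have := abs_le.1 (hej v hv j)
        simp; linarith
      · have := abs_le.1 (hej v hv j)
        simp; linarith
    · simp only [Fintype.sum_sum_type, Sum.elim_inl, Sum.elim_inr, norm_neg, PiLp.norm_single, norm_one, mul_one]
      rw [← Finset.sum_add_distrib]
      have h1 : ∑ j : Fin d, ((τ + e v j) / 2 + (τ - e v j) / 2) = d * τ := by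
        rw [Finset.sum_congr rfl (g := fun _ => τ) (fun j _ => by ring)]; simp
      have h2 : ∑ i : t, A i v * ‖(i : Euc d)‖ ≤ ρ := by
        calc _ ≤ ∑ i : t, A i v * ρ := Finset.sum_le_sum fun i _ => mul_le_mul_of_nonneg_left (hti i) (hA0 v hv i)
          _ = ρ := by rw [← Finset.sum_mul, hA1 v hv, one_mul]
      have h3 : (d + 1) * τ = 1 - ρ := by rw [hτ]; field_simp
      rw [h1]; linarith
    · simp only [Fintype.sum_sum_type, Sum.elim_inl, Sum.elim_inr]
      rw [← Finset.sum_add_distrib]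
      have h1 : ∑ j : Fin d, (((τ + e v j) / 2) • (EuclideanSpace.single j (1:ℝ) : Euc d) + ((τ - e v j) / 2) • (-EuclideanSpace.single j (1:ℝ) : Euc d)) = e v := by
        rw [Finset.sum_congr rfl (g := fun j => e v j • (EuclideanSpace.single j (1:ℝ) : Euc d)) (fun j _ => by
          rw [smul_neg, ← sub_eq_add_neg, ← sub_smul]; congr 1; ring)]
        ext k
        simp [Pi.single_apply]
      rw [h1]; simp [e]

lemma decomp (d : ℕ) (ρ : ℝ) (hρ : ρ < 1) (Φ : Euc d → Euc d) (hΦ : ContDiff ℝ 1 Φ)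
    (hc : HasCompactSupport Φ) (hΦρ : ∀ x, ‖Φ x‖ ≤ ρ) :
    ∃ (ι : Type) (_ : Fintype ι) (p : ι → Euc d → ℝ) (w : ι → Euc d),
      (∀ i, ContDiff ℝ 1 (p i)) ∧ (∀ i, HasCompactSupport (fderiv ℝ (p i))) ∧
      (∀ i x, 0 ≤ p i x) ∧ (∀ i x, p i x ≤ 1) ∧ (∀ x, ∑ i, p i x * ‖w i‖ ≤ 1) ∧
      ∀ x, diverg Φ x = ∑ i, fderiv ℝ (p i) x (w i) := by
  obtain ⟨ι, hι, P, w, h1, h2⟩ := decomp_aux d ρ hρ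
  have hC := h1 Φ hΦ hΦρ
  refine ⟨ι, hι, fun i x => P i (Φ x), w, hC, fun i => ?_, fun i x => (h2 _ (hΦρ x)).1 i,
    fun i x => (h2 _ (hΦρ x)).2.1 i, fun x => (h2 _ (hΦρ x)).2.2.1, fun x => ?_⟩
  · refine HasCompactSupport.intro hc fun x hx => ?_
    have h0 : Φ =ᶠ[nhds x] 0 := notMem_tsupport_iff_eventuallyEq.1 hx
    have : (fun x => P i (Φ x)) =ᶠ[nhds x] fun _ => P i 0 := by
      filter_upwards [h0] with y hy
      simp [hy]
    rw [this.fderiv_eq]; simp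
  · have hd : ∀ i, HasFDerivAt (fun x => P i (Φ x)) (fderiv ℝ (fun x => P i (Φ x)) x) x := fun i =>
      ((hC i).differentiable (by norm_num) x).hasFDerivAt
    have hΦe : Φ = fun x => ∑ i, P i (Φ x) • w i := by
      ext1 x; exact ((h2 _ (hΦρ x)).2.2.2).symm
    have hD : HasFDerivAt Φ (∑ i, (fderiv ℝ (fun x => P i (Φ x)) x).smulRight (w i)) x := by
      have := HasFDerivAt.fun_sum (u := Finset.univ) (fun i _ => (hd i).smul_const (w i))
      exact this.congr_of_eventuallyEq (Eventually.of_forall fun y => congrFun hΦe y)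
    unfold diverg
    rw [hD.fderiv]
    simp only [sum_apply, ContinuousLinearMap.smulRight_apply, WithLp.ofLp_sum, Finset.sum_apply, PiLp.smul_apply, smul_eq_mul]
    rw [Finset.sum_comm]
    refine Finset.sum_congr rfl fun i _ => ?_
    conv_rhs => rw [show w i = ∑ j, w i j • EuclideanSpace.single j (1:ℝ) by ext k; simp [Pi.single_apply]]
    simp [mul_comm]

lemma V_lower (d : ℕ) (ι : Type) [Fintype ι] (p : ι → Euc d → ℝ) (w : ι → Euc d)
    (hp : ∀ i, ContDiff ℝ 1 (p i)) (hc : ∀ i, HasCompactSupport (fderiv ℝ (p i)))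
    (h0 : ∀ i x, 0 ≤ p i x) (h1 : ∀ i x, p i x ≤ 1) (hs : ∀ x, ∑ i, p i x * ‖w i‖ ≤ 1)
    (E : Set (Euc d)) (hE : MeasurableSet E) (hEf : volume E < ⊤) (η : ℝ) (hη : 0 < η) :
    ∀ᶠ δ in nhdsWithin (0 : ℝ) (Ioi 0), ∀ F : Set (Euc d), MeasurableSet F → volume F < ⊤ →
      volume (F ∆ E) < ENNReal.ofReal δ → ∀ h : Euc d, ‖h‖ < δ →
      (1 / 2) * (∑ i, ‖w i‖ * (Real.sign (inner ℝ h (w i)) * ∫ x in E, fderiv ℝ (p i) x h)) - η * ‖h‖ ≤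
        (volume (F \ (fun x => x + h) ⁻¹' F)).toReal := by
  set W := ∑ i, ‖w i‖ with hW
  have hW0 : 0 ≤ W := Finset.sum_nonneg fun i _ => norm_nonneg _
  have hev := eventually_all.2 fun i => per_i d (p i) (hp i) (hc i) (h0 i) (h1 i) E hE hEf (η / (W + 1)) (by positivity)
  filter_upwards [hev] with δ H F hF hFf hFE h hh
  have hpc : ∀ i, Continuous (p i) := fun i => (hp i).continuous
  set c : ι → ℝ := fun i => Real.sign (inner ℝ h (w i)) with hcdef
  have hc1 : ∀ i, |c i| ≤ 1 := fun i => abs_sign_le _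
  set ψ : Euc d → ℝ := fun x => 1 / 2 + 1 / 2 * ∑ i, ‖w i‖ * (c i * p i x) with hψ
  have hψb : ∀ x, |∑ i, ‖w i‖ * (c i * p i x)| ≤ 1 := by
    intro x
    refine (Finset.abs_sum_le_sum_abs _ _).trans ((Finset.sum_le_sum fun i _ => ?_).trans (hs x))
    rw [abs_mul, abs_mul, abs_norm, abs_of_nonneg (h0 i x), mul_comm]
    refine mul_le_mul_of_nonneg_right ?_ (norm_nonneg _)
    have := mul_le_mul_of_nonneg_right (hc1 i) (h0 i x)
    linarith
  have hm := measure_lower d F hF hFf h ψ (by fun_prop) (fun x => by have := abs_le.1 (hψb x); simp only [hψ]; linarith)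
    (fun x => by have := abs_le.1 (hψb x); simp only [hψ]; linarith)
  refine le_trans ?_ hm
  have hpi : ∀ i, IntegrableOn (fun x => p i x - p i (x - h)) F := by
    intro i
    have := hpc i
    refine Measure.integrableOn_of_bounded (M := 1) hFf.ne (by fun_prop) (ae_of_all _ fun x => ?_)
    rw [Real.norm_eq_abs, abs_le]
    constructor <;> linarith [h0 i x, h1 i x, h0 i (x - h), h1 i (x - h)]
  have e1 : ∫ x in F, (ψ x - ψ (x - h)) = 1 / 2 * ∑ i, ‖w i‖ * (c i * ∫ x in F, (p i x - p i (x - h))) := by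
    have : ∀ x, ψ x - ψ (x - h) = 1 / 2 * ∑ i, ‖w i‖ * (c i * (p i x - p i (x - h))) := by
      intro x
      simp only [hψ, mul_sub, Finset.sum_sub_distrib]; ring
    simp_rw [this]
    rw [integral_const_mul, integral_finsetSum _ (fun i _ => ((hpi i).const_mul _).const_mul _)]
    simp_rw [integral_const_mul]
  rw [e1]
  have e2 : ∑ i, ‖w i‖ * (c i * ∫ x in E, fderiv ℝ (p i) x h) - W * (η / (W + 1) * ‖h‖) ≤ ∑ i, ‖w i‖ * (c i * ∫ x in F, (p i x - p i (x - h))) := by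
    rw [hW, Finset.sum_mul, ← Finset.sum_sub_distrib]
    refine Finset.sum_le_sum fun i _ => ?_
    rw [← mul_sub]
    refine mul_le_mul_of_nonneg_left ?_ (norm_nonneg _)
    have := H i F hF hFf hFE h hh
    have h3 : |c i * ((∫ x in F, (p i x - p i (x - h))) - ∫ x in E, fderiv ℝ (p i) x h)| ≤ η / (W + 1) * ‖h‖ := by
      rw [abs_mul]
      calc _ ≤ 1 * _ := mul_le_mul_of_nonneg_right (hc1 i) (abs_nonneg _)
        _ ≤ _ := by rw [one_mul]; exact this
    have := (abs_le.1 h3).1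
    rw [mul_sub] at this
    linarith
  have e3 : W * (η / (W + 1) * ‖h‖) ≤ 2 * (η * ‖h‖) := by
    have : W * (η / (W + 1)) ≤ η := by
      rw [mul_div_assoc', div_le_iff₀ (by positivity)]; nlinarith
    have h2 := mul_le_mul_of_nonneg_right this (norm_nonneg h)
    have : 0 ≤ η * ‖h‖ := by positivity
    linarith
  linarith

lemma exists_g (d : ℕ) (p : Euc d → ℝ) (hp : ContDiff ℝ 1 p) (hc : HasCompactSupport (fderiv ℝ p)) (E : Set (Euc d)) :
    ∃ g : Euc d, ∀ h, ∫ x in E, fderiv ℝ p x h = inner ℝ h g := by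
  have hcont : Continuous (fderiv ℝ p) := hp.continuous_fderiv (by norm_num)
  refine ⟨(InnerProductSpace.toDual ℝ (Euc d)).symm (∫ x in E, fderiv ℝ p x), fun h => ?_⟩
  rw [real_inner_comm, InnerProductSpace.toDual_symm_apply, ContinuousLinearMap.integral_apply]
  exact (hcont.integrable_of_hasCompactSupport hc).integrableOn

lemma ofReal_integral_le {α : Type*} [MeasurableSpace α] (μ : Measure α) (f : α → ℝ) :
    ENNReal.ofReal (∫ x, f x ∂μ) ≤ ∫⁻ x, ENNReal.ofReal (f x) ∂μ := by
  by_cases hf : Integrable f μ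
  · rw [integral_eq_lintegral_pos_part_sub_lintegral_neg_part hf]
    refine ENNReal.ofReal_le_of_le_toReal ?_
    linarith [ENNReal.toReal_nonneg (a := ∫⁻ a, ENNReal.ofReal (-f a) ∂μ)]
  · simp [integral_undef hf]

lemma sign_pos_mul (t x : ℝ) (ht : 0 < t) : Real.sign (t * x) = Real.sign x := by
  rcases lt_trichotomy x 0 with h | h | h
  · rw [Real.sign_of_neg h, Real.sign_of_neg (mul_neg_of_pos_of_neg ht h)]
  · simp [h]
  · rw [Real.sign_of_pos h, Real.sign_of_pos (by positivity)]

lemma ker_nonneg (d : ℕ) (s r t : ℝ) (hr : 0 < r) : 0 ≤ ker d s r t := by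
  unfold _root_.ker
  split_ifs with h
  · positivity
  · have : 0 < t := by linarith
    positivity

lemma core (d : ℕ) (hd : 2 ≤ d) (ρ : ℝ) (hρ : ρ < 1) (Φ : Euc d → Euc d) (hΦ : ContDiff ℝ 1 Φ)
    (hc : HasCompactSupport Φ) (hΦρ : ∀ x, ‖Φ x‖ ≤ ρ)
    (E : Set (Euc d)) (hE : MeasurableSet E) (hEf : volume E < ⊤) (η : ℝ) (hη : 0 < η) :
    ∀ᶠ δ in nhdsWithin (0 : ℝ) (Ioi 0), ∀ F : Set (Euc d), MeasurableSet F → volume F < ⊤ →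
      volume (F ∆ E) < ENNReal.ofReal δ → ∀ s r : ℝ, 0 < r →
      ENNReal.ofReal ((∫ t in Ioi (0 : ℝ), t ^ d * (if t < δ then ker d s r t else 0)) *
        (omegaB (d - 1) * (∫ x in E, diverg Φ x) - η)) ≤ Jt d s r F := by
  obtain ⟨ι, hι, p, w, hp, hpc, h0, h1, hs, hdiv⟩ := decomp d ρ hρ Φ hΦ hc hΦρ
  choose g hg using fun i => exists_g d (p i) (hp i) (hpc i) E
  set Γ := Real.Gamma (((d : ℝ) + 1) / 2) with hΓ
  have hΓ0 : 0 < Γ := Real.Gamma_pos_of_pos (by positivity)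
  set M := ∫ x : Euc d, Real.exp (-‖x‖ ^ 2) * ‖x‖ with hM
  have hM0 : 0 ≤ M := integral_nonneg fun x => by positivity
  set η' := η * Γ / (2 * (M + 1)) with hη'
  have hη'0 : 0 < η' := by positivity
  have hdivI : ∫ x in E, diverg Φ x = ∑ i, inner ℝ (w i) (g i) := by
    simp_rw [hdiv]
    rw [integral_finsetSum]
    · simp_rw [hg]
    · intro i _
      have hcont : Continuous (fderiv ℝ (p i)) := (hp i).continuous_fderiv (by norm_num)
      exact (((hcont.integrable_of_hasCompactSupport (hpc i)).integrableOn (s := E)).apply_continuousLinearMap (w i))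
  filter_upwards [V_lower d ι p w hp hpc h0 h1 hs E hE hEf η' hη'0] with δ H F hF hFf hFE s r hr
  set Λ : Euc d → ℝ := fun h => (1 / 2) * (∑ i, ‖w i‖ * (Real.sign (inner ℝ h (w i)) * inner ℝ h (g i))) - η' * ‖h‖ with hΛ
  have hhom : ∀ t : ℝ, 0 < t → ∀ x, Λ (t • x) = t * Λ x := by
    intro t ht x
    simp only [hΛ, inner_smul_left, norm_smul, Real.norm_of_nonneg ht.le, mul_sub, Finset.mul_sum]
    simp only [conj_trivial, sign_pos_mul _ _ ht]
    congr 1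
    · refine Finset.sum_congr rfl fun i _ => by ring
    · ring
  have hgauss := polar_hom d hd Λ hhom (fun t => Real.exp (-t ^ 2))
  rw [gamma_half] at hgauss
  have hgv : ∫ x : Euc d, Real.exp (-‖x‖ ^ 2) * Λ x = 1 / 2 * (√Real.pi ^ (d - 1) * ∫ x in E, diverg Φ x) - η' * M := by
    have hi1 : ∀ i, Integrable (fun x : Euc d => ‖w i‖ * (Real.exp (-‖x‖ ^ 2) * (Real.sign (inner ℝ x (w i)) * inner ℝ x (g i)))) :=
      fun i => (integrable_gauss' d (w i) (g i)).const_mul _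
    have : ∀ x : Euc d, Real.exp (-‖x‖ ^ 2) * Λ x = 1 / 2 * (∑ i, ‖w i‖ * (Real.exp (-‖x‖ ^ 2) * (Real.sign (inner ℝ x (w i)) * inner ℝ x (g i)))) - η' * (Real.exp (-‖x‖ ^ 2) * ‖x‖) := by
      intro x
      simp only [hΛ, mul_sub, Finset.mul_sum]
      congr 1
      · refine Finset.sum_congr rfl fun i _ => by ring
      · ring
    simp_rw [this]
    rw [integral_sub ((integrable_finsetSum _ fun i _ => hi1 i).const_mul _) ((integrable_gauss d).const_mul _),
      integral_const_mul, integral_const_mul, integral_finsetSum _ fun i _ => hi1 i]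
    simp_rw [integral_const_mul, gauss_inner d hd]
    rw [hdivI, hM]
    simp only [Finset.mul_sum]
  have hS : omegaB (d - 1) * (∫ x in E, diverg Φ x) - η ≤ ∫ θ : sphere (0 : Euc d) 1, Λ θ ∂(volume : Measure (Euc d)).toSphere := by
    have e1 : ∫ θ : sphere (0 : Euc d) 1, Λ θ ∂(volume : Measure (Euc d)).toSphere = 2 / Γ * (1 / 2 * (√Real.pi ^ (d - 1) * ∫ x in E, diverg Φ x) - η' * M) := by
      rw [← hgv, hgauss, ← hΓ]
      field_simp
    rw [e1, omegaB_eq d hd, ← hΓ, hη']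
    have e2 : 2 / Γ * (1 / 2 * (√Real.pi ^ (d - 1) * ∫ x in E, diverg Φ x) - η * Γ / (2 * (M + 1)) * M) = √Real.pi ^ (d - 1) / Γ * (∫ x in E, diverg Φ x) - η * (M / (M + 1)) := by
      field_simp
    rw [e2]
    have : M / (M + 1) ≤ 1 := by rw [div_le_one (by positivity)]; linarith
    nlinarith
  have hA : 0 ≤ ∫ t in Ioi (0 : ℝ), t ^ d * (if t < δ then ker d s r t else 0) := by
    refine setIntegral_nonneg measurableSet_Ioi fun t ht => ?_
    have := ker_nonneg d s r t hr
    have ht' : 0 < t := ht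
    split_ifs <;> positivity
  calc _ ≤ ENNReal.ofReal ((∫ t in Ioi (0 : ℝ), t ^ d * (if t < δ then ker d s r t else 0)) * ∫ θ : sphere (0 : Euc d) 1, Λ θ ∂(volume : Measure (Euc d)).toSphere) :=
        ENNReal.ofReal_le_ofReal (mul_le_mul_of_nonneg_left hS hA)
    _ = ENNReal.ofReal (∫ h, (if ‖h‖ < δ then ker d s r ‖h‖ else 0) * Λ h) := by
        rw [polar_hom d hd Λ hhom (fun t => if t < δ then ker d s r t else 0), mul_comm]
    _ ≤ ∫⁻ h, ENNReal.ofReal ((if ‖h‖ < δ then ker d s r ‖h‖ else 0) * Λ h) := ofReal_integral_le _ _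
    _ ≤ Jt d s r F := by
        rw [Jt_eq d s r F hF]
        refine lintegral_mono fun h => ?_
        simp only
        split_ifs with hh
        · rw [ENNReal.ofReal_mul (ker_nonneg _ _ _ _ hr)]
          gcongr
          have := H F hF hFf hFE h hh
          simp only [hg] at this
          exact ENNReal.ofReal_le_of_le_toReal this
        · simp

lemma radial (d : ℕ) (r s δ : ℝ) (hr : 0 < r) (hrδ : r < δ) (hs : 1 < s) :
    ∫ t in Ioi (0 : ℝ), t ^ d * (if t < δ then ker d s r t else 0) =
      betaScale d s r - (δ ^ (1 - s) - 1) / (s - 1) := by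
  have hs' : s - 1 ≠ 0 := by linarith
  have hδ : 0 < δ := hr.trans hrδ
  have e1 : ∫ t in Ioi (0 : ℝ), t ^ d * (if t < δ then ker d s r t else 0) = ∫ t in Ioo (0 : ℝ) δ, t ^ d * ker d s r t := by
    rw [← integral_indicator measurableSet_Ioi, ← integral_indicator measurableSet_Ioo]
    congr with t
    by_cases h1 : 0 < t <;> by_cases h2 : t < δ <;> simp [h1, h2, indicator]
  have c1 : EqOn (fun t => t ^ d * r ^ (-((d : ℝ) + s))) (fun t => t ^ d * ker d s r t) (Ioc 0 r) := by
    intro t ht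
    simp [_root_.ker, ht.2]
  have c2 : EqOn (fun t => t ^ (-s)) (fun t => t ^ d * ker d s r t) (Ioc r δ) := by
    intro t ht
    have ht0 : 0 < t := hr.trans ht.1
    simp only [_root_.ker, not_le.2 ht.1, if_false]
    rw [← Real.rpow_natCast, ← Real.rpow_add ht0]
    congr 1; ring
  have i1 : IntervalIntegrable (fun t => t ^ d * r ^ (-((d : ℝ) + s))) volume 0 r :=
    Continuous.intervalIntegrable (by fun_prop) _ _
  have i2 : IntervalIntegrable (fun t => t ^ (-s)) volume r δ := by
    refine intervalIntegral.intervalIntegrable_rpow (Or.inr ?_)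
    rw [uIcc_of_le hrδ.le]; intro h; linarith [h.1]
  have i1' : IntervalIntegrable (fun t => t ^ d * ker d s r t) volume 0 r :=
    i1.congr (by rw [uIoc_of_le hr.le]; exact c1)
  have i2' : IntervalIntegrable (fun t => t ^ d * ker d s r t) volume r δ :=
    i2.congr (by rw [uIoc_of_le hrδ.le]; exact c2)
  rw [e1, ← integral_Ioc_eq_integral_Ioo, ← intervalIntegral.integral_of_le hδ.le,
    ← intervalIntegral.integral_add_adjacent_intervals i1' i2',
    intervalIntegral.integral_of_le hr.le, intervalIntegral.integral_of_le hrδ.le,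
    ← setIntegral_congr_fun measurableSet_Ioc c1, ← setIntegral_congr_fun measurableSet_Ioc c2,
    ← intervalIntegral.integral_of_le hr.le, ← intervalIntegral.integral_of_le hrδ.le,
    intervalIntegral.integral_mul_const, integral_pow, integral_rpow]
  · have h1 : r ^ (d + 1) * r ^ (-((d : ℝ) + s)) = r ^ (1 - s) := by
      rw [← Real.rpow_natCast, ← Real.rpow_add hr]
      congr 1; push_cast; ring
    have h2 : -s + 1 = 1 - s := by ring
    have h3 : (1 - s) ≠ 0 := by linarith
    have h4 : (d : ℝ) + 1 ≠ 0 := by positivity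
    rw [h2, zero_pow (by omega), sub_zero, div_mul_eq_mul_div, h1, betaScale]
    have : (δ ^ (1 - s) - r ^ (1 - s)) / (1 - s) = (r ^ (1 - s) - δ ^ (1 - s)) / (s - 1) := by
      rw [div_eq_div_iff h3 hs']; ring
    rw [this]
    field_simp
    ring
  · refine Or.inr ⟨by linarith, ?_⟩
    rw [uIcc_of_le hrδ.le]; intro h; linarith [h.1]

lemma beta_lower (d : ℕ) (r s : ℝ) (hr : r ∈ Ioo (0:ℝ) 1) (hs : 1 < s) : -Real.log r ≤ betaScale d s r := by
  have hs' : 0 < s - 1 := by linarith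
  have h1 : -Real.log r ≤ (r ^ (1 - s) - 1) / (s - 1) := by
    rw [le_div_iff₀ hs', Real.rpow_def_of_pos hr.1]
    have := Real.add_one_le_exp (Real.log r * (1 - s))
    nlinarith
  have h0 : 0 ≤ -Real.log r := by linarith [Real.log_neg hr.1 hr.2]
  have h2 : 1 ≤ ((d : ℝ) + s) / ((d : ℝ) + 1) := by
    rw [le_div_iff₀ (by positivity)]; linarith
  have h3 : 0 ≤ 1 / ((d : ℝ) + 1) := by positivity
  unfold betaScale
  nlinarith

lemma err_upper (δ s : ℝ) (hδ : δ ∈ Ioo (0:ℝ) 1) (hs : 1 < s) (hs2 : s ≤ 2) :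
    (δ ^ (1 - s) - 1) / (s - 1) ≤ -Real.log δ * δ⁻¹ := by
  have hs' : 0 < s - 1 := by linarith
  have h0 : 0 ≤ -Real.log δ := by linarith [Real.log_neg hδ.1 hδ.2]
  have hp : 0 < δ ^ (1 - s) := Real.rpow_pos_of_pos hδ.1 _
  have h2 : δ ^ (1 - s) ≤ δ⁻¹ := by
    rw [← Real.rpow_neg_one]
    exact Real.rpow_le_rpow_of_exponent_ge hδ.1 hδ.2.le (by linarith)
  have h1 : δ ^ (1 - s) - 1 ≤ (s - 1) * (-Real.log δ) * δ ^ (1 - s) := by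
    have := Real.add_one_le_exp (Real.log δ * (s - 1))
    rw [← Real.rpow_def_of_pos hδ.1] at this
    have h3 : δ ^ (s - 1) * δ ^ (1 - s) = 1 := by
      rw [← Real.rpow_add hδ.1]; simp
    nlinarith
  rw [div_le_iff₀ hs']
  have := mul_le_mul_of_nonneg_left h2 (mul_nonneg hs'.le h0)
  linarith

/-- **Γ-liminf inequality for simultaneous limits `r_n → 0⁺`, `s_n → 1⁺`.** -/
theorem stmt16 (d : ℕ) (hd : 2 ≤ d)
    (r : ℕ → ℝ) (hr : ∀ n, r n ∈ Set.Ioo (0 : ℝ) 1) (hr0 : Tendsto r atTop (nhds 0))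
    (s : ℕ → ℝ) (hs : ∀ n, 1 < s n) (hs1 : Tendsto s atTop (nhds 1))
    (E : Set (Euc d)) (hEmeas : MeasurableSet E) (hEfin : volume E < ⊤)
    (En : ℕ → Set (Euc d)) (hEnmeas : ∀ n, MeasurableSet (En n))
    (hEnfin : ∀ n, volume (En n) < ⊤)
    (hconv : Tendsto (fun n => volume ((En n) ∆ E)) atTop (nhds 0)) :
    ENNReal.ofReal (omegaB (d - 1)) * Per d E ≤
      Filter.liminf
        (fun n => Jt d (s n) (r n) (En n) / ENNReal.ofReal (betaScale d (s n) (r n)))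
        atTop := by
  set L := Filter.liminf
        (fun n => Jt d (s n) (r n) (En n) / ENNReal.ofReal (betaScale d (s n) (r n))) atTop with hL
  have key : ∀ Φ : Euc d → Euc d, ContDiff ℝ 1 Φ → HasCompactSupport Φ → ∀ ρ < 1, (∀ x, ‖Φ x‖ ≤ ρ) →
      ∀ η > 0, ENNReal.ofReal (omegaB (d - 1) * (∫ x in E, diverg Φ x) - η) ≤ L := by
    intro Φ hΦ hc ρ hρ hΦρ η hη
    set B := omegaB (d - 1) * (∫ x in E, diverg Φ x) - η with hB
    obtain ⟨δ, hcore, hδ⟩ := ((core d hd ρ hρ Φ hΦ hc hΦρ E hEmeas hEfin η hη).and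
      (Ioo_mem_nhdsGT (zero_lt_one' ℝ))).exists
    have hbeta : Tendsto (fun n => betaScale d (s n) (r n)) atTop atTop := by
      refine tendsto_atTop_mono (fun n => beta_lower d (r n) (s n) (hr n) (hs n)) ?_
      refine tendsto_neg_atBot_atTop.comp (Real.tendsto_log_nhdsGT_zero.comp ?_)
      exact tendsto_nhdsWithin_iff.2 ⟨hr0, Eventually.of_forall fun n => (hr n).1⟩
    set K := -Real.log δ * δ⁻¹ with hK
    have hlim : Tendsto (fun n => (1 - K / betaScale d (s n) (r n)) * B) atTop (nhds B) := by
      have h1 : Tendsto (fun n => K / betaScale d (s n) (r n)) atTop (nhds 0) := hbeta.const_div_atTop K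
      simpa using (tendsto_const_nhds (x := (1:ℝ)).sub h1).mul_const B
    rcases le_or_gt B 0 with hB0 | hB0
    · rw [ENNReal.ofReal_of_nonpos hB0]; exact zero_le
    have hlim2 := (ENNReal.tendsto_ofReal hlim)
    rw [← hlim2.liminf_eq, hL]
    refine liminf_le_liminf ?_
    have hv : ∀ᶠ n in atTop, volume ((En n) ∆ E) < ENNReal.ofReal δ :=
      hconv.eventually_lt_const (ENNReal.ofReal_pos.2 hδ.1)
    filter_upwards [hv, hr0.eventually_lt_const hδ.1, hs1.eventually_le_const (by norm_num : (1:ℝ) < 2),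
      hbeta.eventually_gt_atTop 0] with n h1 h2 h3 h4
    have hJ := hcore (En n) (hEnmeas n) (hEnfin n) h1 (s n) (r n) (hr n).1
    rw [radial d (r n) (s n) δ (hr n).1 h2 (hs n)] at hJ
    rw [ENNReal.le_div_iff_mul_le (Or.inl (ENNReal.ofReal_pos.2 h4).ne') (Or.inl ENNReal.ofReal_ne_top),
      ← ENNReal.ofReal_mul' h4.le]
    refine le_trans (ENNReal.ofReal_le_ofReal ?_) hJ
    have he := err_upper δ (s n) hδ (hs n) h3
    have : (1 - K / betaScale d (s n) (r n)) * B * betaScale d (s n) (r n) = (betaScale d (s n) (r n) - K) * B := by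
      field_simp
    rw [this]
    exact mul_le_mul_of_nonneg_right (by linarith) hB0.le
  unfold Per
  simp only [ENNReal.mul_iSup]
  refine iSup_le fun Φ => iSup_le fun hΦ => iSup_le fun hc => iSup_le fun hb => ?_
  have hω : 0 ≤ omegaB (d - 1) := ENNReal.toReal_nonneg
  rw [← ENNReal.ofReal_mul hω]
  have hlim : Tendsto (fun ε : ℝ => ENNReal.ofReal (omegaB (d - 1) * ((1 - ε) * ∫ x in E, diverg Φ x) - ε))
      (nhdsWithin 0 (Ioi 0)) (nhds (ENNReal.ofReal (omegaB (d - 1) * ∫ x in E, diverg Φ x))) := by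
    refine ENNReal.tendsto_ofReal (tendsto_nhdsWithin_of_tendsto_nhds ?_)
    have : Continuous (fun ε : ℝ => omegaB (d - 1) * ((1 - ε) * ∫ x in E, diverg Φ x) - ε) := by fun_prop
    simpa using this.tendsto 0
  refine le_of_tendsto hlim ?_
  filter_upwards [Ioo_mem_nhdsGT (zero_lt_one' ℝ)] with ε hε
  have h1 := key (fun x => (1 - ε) • Φ x) (by fun_prop) (hc.smul_left (f := fun _ => 1 - ε)) (1 - ε) (by linarith [hε.1])
    (fun x => by
      rw [norm_smul, Real.norm_of_nonneg (by linarith [hε.2])]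
      exact mul_le_of_le_one_right (by linarith [hε.2]) (hb x)) ε hε.1
  have h2 : ∀ x, diverg (fun x => (1 - ε) • Φ x) x = (1 - ε) * diverg Φ x := by
    intro x
    unfold diverg
    rw [fderiv_fun_const_smul (hΦ.differentiable (by norm_num) x), Finset.mul_sum]
    simp
  simp_rw [h2, integral_const_mul] at h1
  exact h1

end
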